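/- arXiv:2605.05457 — 2 statements merged into one kernel-verified Lean document; each statement's English description precedes it below -/
import Mathlib

section
/- Let q be a prime power and F_q the finite field with q elements. The number of invertible 3×3 matrices B over F_q satisfying b_{11} + b_{22} = 0 (where b_{11}, b_{22} are the (1,1) and (2,2) entries of B) equals q^3(q-1)^2(q^3+q^2-1) = q^8 - q^7 - q^6 + 2q^4 - q^3. -/
section aux
variable {F : Type*} [Field F] [Fintype F] [DecidableEq F]

/-- Determinant of the matrix with rows `(a,b,c)`, `(d,-a,f)`, `(g,h,i)`. -/
def auxDet (a b d g h c f i : F) : F :=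
  -(a * a + b * d) * i + ((d * h + a * g) * c + (b * g - a * h) * f)

lemma sum_ite_val (x0 : F) (A B : ℤ) :
    ∑ x : F, (if x = x0 then B else A) = ((Fintype.card F : ℤ) - 1) * A + B := by
  have h : ∀ x : F, (if x = x0 then B else A) = A + (if x = x0 then B - A else 0) := by
    intro x; split_ifs <;> ring
  simp only [h, Finset.sum_add_distrib, Finset.sum_ite_eq', Finset.mem_univ, if_true]
  simp
  ring

lemma sum_lin (α β : F) (hα : α ≠ 0) (A B : ℤ) :
    ∑ x : F, (if α * x + β = 0 then B else A) = ((Fintype.card F : ℤ) - 1) * A + B := by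
  rw [← sum_ite_val (-β / α) A B]
  refine Finset.sum_congr rfl fun x _ => ?_
  have : α * x + β = 0 ↔ x = -β / α := by
    rw [eq_div_iff hα]
    constructor <;> intro h <;> linear_combination h
  simp only [this]

lemma sum_lin2 (α β : F) (h : ¬(α = 0 ∧ β = 0)) (A : ℤ) :
    ∑ x : F, ∑ y : F, (if α * x + β * y = 0 then 0 else A) =
      ((Fintype.card F : ℤ) - 1) * Fintype.card F * A := by
  by_cases hα : α = 0
  · have hβ : β ≠ 0 := fun hb => h ⟨hα, hb⟩
    have : ∀ x y : F, α * x + β * y = β * y + 0 := by intro x y; rw [hα]; ring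
    simp only [this, sum_lin β 0 hβ A 0]
    simp
    ring
  · rw [Finset.sum_comm]
    simp only [sum_lin α _ hα A 0]
    simp
    ring

lemma sum_block (a b d : F) :
    ∑ g : F, ∑ h : F, ∑ c : F, ∑ f : F, ∑ i : F,
      (if auxDet a b d g h c f i = 0 then (0 : ℤ) else 1) =
    if b * d + a * a = 0 then
      (if b = 0 ∧ d = 0 then 0 else
        ((Fintype.card F : ℤ) - 1) ^ 2 * (Fintype.card F : ℤ) ^ 3)
    else (Fintype.card F : ℤ) ^ 4 * ((Fintype.card F : ℤ) - 1) := by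
  by_cases hD : b * d + a * a = 0
  · rw [if_pos hD]
    have h1 : ∀ g h c f i : F, auxDet a b d g h c f i =
        (d * h + a * g) * c + (b * g - a * h) * f := by
      intro g h c f i
      unfold auxDet
      linear_combination (-i) * hD
    simp only [h1, Finset.sum_const, Finset.card_univ, nsmul_eq_mul]
    simp only [← Finset.mul_sum]
    have h2 : ∀ g h : F, ∑ c : F, ∑ f : F,
        (if (d * h + a * g) * c + (b * g - a * h) * f = 0 then (0 : ℤ) else 1) =
        if d * h + a * g = 0 ∧ b * g - a * h = 0 then 0 else
          ((Fintype.card F : ℤ) - 1) * Fintype.card F * 1 := by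
      intro g h
      split_ifs with hh
      · simp [hh.1, hh.2]
      · exact sum_lin2 _ _ hh 1
    simp only [h2]
    by_cases hb : b = 0
    · have ha : a = 0 := by
        rw [hb] at hD; simpa using hD
      by_cases hd : d = 0
      · simp [ha, hb, hd]
      · have h3 : ∀ g h : F, (d * h + a * g = 0 ∧ b * g - a * h = 0) ↔ 0 * g + d * h = 0 := by
          intro g h; simp [ha, hb]
        simp only [h3]
        rw [sum_lin2 0 d (by simp [hd])]
        simp [hd]
        ring
    · have h3 : ∀ g h : F, (d * h + a * g = 0 ∧ b * g - a * h = 0) ↔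
          b * g + (-a) * h = 0 := by
        intro g h
        constructor
        · rintro ⟨_, h⟩; linear_combination h
        · intro hh
          refine ⟨?_, by linear_combination hh⟩
          apply mul_left_cancel₀ hb
          linear_combination h * hD + a * hh
      simp only [h3]
      rw [sum_lin2 b (-a) (by simp [hb])]
      simp [hb]
      ring
  · rw [if_neg hD]
    have hD' : -(a * a + b * d) ≠ 0 := by
      intro h; apply hD; linear_combination -h
    unfold auxDet
    simp only [sum_lin _ _ hD' 1 0]
    simp
    ring

lemma sum_total :
    ∑ a : F, ∑ b : F, ∑ d : F, ∑ g : F, ∑ h : F, ∑ c : F, ∑ f : F, ∑ i : F,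
      (if auxDet a b d g h c f i = 0 then (0 : ℤ) else 1) =
    (Fintype.card F : ℤ) ^ 3 * ((Fintype.card F : ℤ) - 1) ^ 2 *
      ((Fintype.card F : ℤ) ^ 3 + (Fintype.card F : ℤ) ^ 2 - 1) := by
  simp only [sum_block]
  generalize hA : (Fintype.card F : ℤ) ^ 4 * ((Fintype.card F : ℤ) - 1) = A
  generalize hB : ((Fintype.card F : ℤ) - 1) ^ 2 * (Fintype.card F : ℤ) ^ 3 = B
  have h1 : ∀ a b : F, ∑ d : F, (if b * d + a * a = 0 then
      (if b = 0 ∧ d = 0 then 0 else B) else A) =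
      if b = 0 then (if a = 0 then ((Fintype.card F : ℤ) - 1) * B + 0
        else (Fintype.card F : ℤ) * A)
      else ((Fintype.card F : ℤ) - 1) * A + B := by
    intro a b
    by_cases hb : b = 0
    · by_cases ha : a = 0
      · rw [if_pos hb, if_pos ha, ← sum_ite_val (0 : F) B 0]
        simp [hb, ha]
      · simp [hb, ha]
    · simp only [hb, false_and, if_false]
      exact sum_lin b _ hb A B
  simp only [h1, sum_ite_val]
  have h2 := fun X Y Z : ℤ => sum_ite_val (F := F) 0 (X + Y) (X + Z)
  simp only [Finset.sum_add_distrib, sum_ite_val]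
  simp
  rw [← hA, ← hB]
  ring

/-- Parametrisation of the matrices by eight free entries. -/
def auxEquiv : {B : GL (Fin 3) F //
        (B : Matrix (Fin 3) (Fin 3) F) 0 0 + (B : Matrix (Fin 3) (Fin 3) F) 1 1 = 0} ≃
    {x : F × F × F × F × F × F × F × F //
      ¬ auxDet x.1 x.2.1 x.2.2.1 x.2.2.2.1 x.2.2.2.2.1 x.2.2.2.2.2.1 x.2.2.2.2.2.2.1
        x.2.2.2.2.2.2.2 = 0} where
  toFun B := ⟨(B.1.1 0 0, B.1.1 0 1, B.1.1 1 0, B.1.1 2 0, B.1.1 2 1, B.1.1 0 2, B.1.1 1 2,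
    B.1.1 2 2), by
      obtain ⟨B, hB⟩ := B
      have h := ((Matrix.isUnit_iff_isUnit_det _).1 B.isUnit).ne_zero
      intro h0
      apply h
      rw [Matrix.det_fin_three]
      unfold auxDet at h0
      have : (B : Matrix (Fin 3) (Fin 3) F) 1 1 = - (B : Matrix (Fin 3) (Fin 3) F) 0 0 := by
        linear_combination hB
      rw [this]
      linear_combination h0⟩
  invFun x := ⟨Matrix.GeneralLinearGroup.mkOfDetNeZero
      !![x.1.1, x.1.2.1, x.1.2.2.2.2.2.1; x.1.2.2.1, -x.1.1, x.1.2.2.2.2.2.2.1;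
        x.1.2.2.2.1, x.1.2.2.2.2.1, x.1.2.2.2.2.2.2.2] (by
        intro h0
        apply x.2
        rw [Matrix.det_fin_three] at h0
        simp at h0
        unfold auxDet
        linear_combination h0), by
      simp [Matrix.GeneralLinearGroup.mkOfDetNeZero]⟩
  left_inv := by
    rintro ⟨B, hB⟩
    have : (B : Matrix (Fin 3) (Fin 3) F) 1 1 = - (B : Matrix (Fin 3) (Fin 3) F) 0 0 := by
      linear_combination hB
    apply Subtype.ext
    apply Units.ext
    ext i j
    fin_cases i <;> fin_cases j <;> simp [Matrix.GeneralLinearGroup.mkOfDetNeZero, this]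
  right_inv := by
    rintro ⟨⟨a, b, d, g, h, c, f, i⟩, hx⟩
    simp [Matrix.GeneralLinearGroup.mkOfDetNeZero]

lemma aux_card : (Nat.card {B : GL (Fin 3) F //
        (B : Matrix (Fin 3) (Fin 3) F) 0 0 + (B : Matrix (Fin 3) (Fin 3) F) 1 1 = 0} : ℤ) =
    (Fintype.card F : ℤ) ^ 3 * ((Fintype.card F : ℤ) - 1) ^ 2 *
      ((Fintype.card F : ℤ) ^ 3 + (Fintype.card F : ℤ) ^ 2 - 1) := by
  rw [Nat.card_congr auxEquiv, ← sum_total, Nat.card_eq_fintype_card, Fintype.card_subtype,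
    Finset.card_filter]
  push_cast
  simp only [Fintype.sum_prod_type, ite_not]

end aux


/-- The number of invertible 3×3 matrices over `F_q` with `b₁₁ + b₂₂ = 0` is
`q^3(q-1)^2(q^3+q^2-1) = q^8 - q^7 - q^6 + 2q^4 - q^3`. -/
theorem card_GL3_diagSum_zero (q : ℕ) (F : Type*) [Field F] [Fintype F] [DecidableEq F]
    (hq : Fintype.card F = q) :
    (Nat.card {B : GL (Fin 3) F //
        (B : Matrix (Fin 3) (Fin 3) F) 0 0 + (B : Matrix (Fin 3) (Fin 3) F) 1 1 = 0} : ℤ) =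
      (q : ℤ) ^ 3 * ((q : ℤ) - 1) ^ 2 * ((q : ℤ) ^ 3 + q ^ 2 - 1) ∧
    (Nat.card {B : GL (Fin 3) F //
        (B : Matrix (Fin 3) (Fin 3) F) 0 0 + (B : Matrix (Fin 3) (Fin 3) F) 1 1 = 0} : ℤ) =
      (q : ℤ) ^ 8 - q ^ 7 - q ^ 6 + 2 * q ^ 4 - q ^ 3 := by
  subst hq
  refine ⟨aux_card, ?_⟩
  rw [aux_card]
  ring
end

section
/- Let q be a prime power and F_q the finite field with q elements. Let M be the complex matrix indexed by Mat_3(F_q) × Mat_3(F_q) defined by M(A,B) = 1 if B - A is invertible and M(A,B) = 0 otherwise. Then the characteristic polynomial of M equals (X - λ_0)^{m_0}·(X - λ_1)^{m_1}·(X - λ_2)^{m_2}·(X - λ_3)^{m_3}, where λ_0 = q^9 - q^8 - q^7 + q^5 + q^4 - q^3 with m_0 = 1, λ_1 = -q^6 + q^5 + q^4 - q^3 with m_1 = q^5 + q^4 + q^3 - q^2 - q - 1, λ_2 = q^4 - q^3 with m_2 = q^8 + q^7 - 2q^5 - 2q^4 + q^2 + q, and λ_3 = -q^3 with m_3 = q^9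 - q^8 - q^7 + q^5 + q^4 - q^3. -/
open Polynomial
open scoped Classical


namespace UG3
open Matrix

variable {F : Type*} [Field F] [Fintype F]

/-- number of factorizations `B = v φ` with `v ≠ 0` -/
noncomputable def aa (B : Matrix (Fin 3) (Fin 3) F) : ℂ :=
  ∑ v : Fin 3 → F, ∑ w : Fin 3 → F, if v ≠ 0 ∧ B = vecMulVec v w then 1 else 0

/-- number of non-zero left kernel vectors -/
noncomputable def bb (B : Matrix (Fin 3) (Fin 3) F) : ℂ :=
  ∑ v : Fin 3 → F, if v ≠ 0 ∧ v ᵥ* B = 0 then 1 else 0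

lemma sum_dot (ψ : AddChar F ℂ) (hψ : ψ.IsPrimitive) (x : Fin 3 → F) :
    ∑ w : Fin 3 → F, ψ (x ⬝ᵥ w) = if x = 0 then (Fintype.card F : ℂ) ^ 3 else 0 := by
  let f : (Fin 3 → F) →+ F :=
    { toFun := fun w => x ⬝ᵥ w, map_zero' := by simp, map_add' := by intros; simp [dotProduct_add] }
  have h := AddChar.sum_eq_ite (ψ.compAddMonoidHom f)
  have h2 : (ψ.compAddMonoidHom f = 0) ↔ x = 0 := by
    constructor
    · intro h
      by_contra hx
      obtain ⟨i, hi⟩ := Function.ne_iff.mp hx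
      apply hψ hi
      ext t
      have := DFunLike.congr_fun h (Pi.single i t)
      simpa [f, AddChar.mulShift_apply] using this
    · rintro rfl
      ext t
      simp [f]
  simp only [h2] at h
  simpa [f] using h

lemma sum_tr (ψ : AddChar F ℂ) (hψ : ψ.IsPrimitive) (B : Matrix (Fin 3) (Fin 3) F) :
    ∑ U : Matrix (Fin 3) (Fin 3) F, ψ (trace (U * B)) =
      if B = 0 then (Fintype.card F : ℂ) ^ 9 else 0 := by
  let f : (Matrix (Fin 3) (Fin 3) F) →+ F :=
    { toFun := fun w => trace (w * B), map_zero' := by simp,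
      map_add' := by intros; simp [add_mul] }
  have h := AddChar.sum_eq_ite (ψ.compAddMonoidHom f)
  have h2 : (ψ.compAddMonoidHom f = 0) ↔ B = 0 := by
    constructor
    · intro h
      by_contra hx
      obtain ⟨i, hi⟩ := Function.ne_iff.mp hx
      obtain ⟨j, hi⟩ := Function.ne_iff.mp hi
      apply hψ hi
      ext t
      have := DFunLike.congr_fun h (single j i t)
      simpa [f, AddChar.mulShift_apply, trace_single_mul, mul_comm] using this
    · rintro rfl
      ext t
      simp [f]
  simp only [h2] at h
  have hc : Fintype.card (Matrix (Fin 3) (Fin 3) F) = Fintype.card F ^ 9 := by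
    rw [show Fintype.card (Matrix (Fin 3) (Fin 3) F) = Fintype.card (Fin 3 → Fin 3 → F) from
      Fintype.card_congr (Equiv.refl _)]
    simp [← pow_mul]
  rw [hc] at h
  simpa [f] using h

lemma bb_eq (B : Matrix (Fin 3) (Fin 3) F) :
    bb B = (Fintype.card F : ℂ) ^ (3 - B.rank) - 1 := by
  have h1 : Fintype.card (LinearMap.ker Bᵀ.mulVecLin) = Fintype.card F ^ (3 - B.rank) := by
    rw [Module.card_eq_pow_finrank (K := F)]
    congr 1
    have := LinearMap.finrank_range_add_finrank_ker Bᵀ.mulVecLin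
    have h2 := rank_transpose B
    simp only [Matrix.rank] at h2 ⊢
    simp at this
    omega
  have h2 : (∑ v : Fin 3 → F, if v ᵥ* B = 0 then (1:ℂ) else 0) = (Fintype.card F : ℂ) ^ (3 - B.rank) := by
    rw [Finset.sum_boole, ← Nat.cast_pow, ← h1, Fintype.card_subtype]
    simp [LinearMap.mem_ker]
  rw [← h2, bb, ← Finset.sum_erase_add _ _ (Finset.mem_univ 0),
    ← Finset.sum_erase_add (a := 0) Finset.univ (fun v : Fin 3 → F => if v ᵥ* B = 0 then (1:ℂ) else 0) (Finset.mem_univ 0)]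
  simp only [ne_eq, not_true, false_and, if_false, zero_vecMul, if_true, add_zero, add_sub_cancel_right]
  apply Finset.sum_congr rfl
  intro v hv
  have : v ≠ 0 := by simpa using hv
  simp [this]

lemma rank_eq_zero_iff' (B : Matrix (Fin 3) (Fin 3) F) : B.rank = 0 ↔ B = 0 := by
  constructor
  · intro h
    rw [Matrix.rank, Submodule.finrank_eq_zero, LinearMap.range_eq_bot] at h
    ext i j
    have := congrFun (LinearMap.congr_fun h (Pi.single j 1)) i
    simpa using this
  · rintro rfl; simp

lemma rank_one_form (B : Matrix (Fin 3) (Fin 3) F) (h : B.rank = 1) :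
    ∃ v w, v ≠ 0 ∧ B = vecMulVec v w := by
  rw [Matrix.rank, finrank_eq_one_iff'] at h
  obtain ⟨⟨v, hv⟩, hv0, h⟩ := h
  choose c hc using fun j => h ⟨B.mulVecLin (Pi.single j 1), LinearMap.mem_range_self _ _⟩
  refine ⟨v, c, fun h => hv0 (by simpa using h), ?_⟩
  ext i j
  have := congrFun (congrArg Subtype.val (hc j)) i
  simp at this
  rw [vecMulVec_apply, ← this, mul_comm]

lemma aa_of_two_le (B : Matrix (Fin 3) (Fin 3) F) (h : 2 ≤ B.rank) : aa B = 0 := by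
  apply Finset.sum_eq_zero; intro v _; apply Finset.sum_eq_zero; intro w _
  rw [if_neg]
  rintro ⟨_, rfl⟩
  have := rank_vecMulVec_le v w
  omega

lemma vmv_zero (v w : Fin 3 → F) (hv : v ≠ 0) (h : vecMulVec v w = 0) : w = 0 := by
  obtain ⟨i, hi⟩ := Function.ne_iff.mp hv
  ext j
  have := congrFun (congrFun h i) j
  simpa [vecMulVec_apply, show v i ≠ 0 from hi] using this

lemma aa_zero : aa (0 : Matrix (Fin 3) (Fin 3) F) = (Fintype.card F : ℂ) ^ 3 - 1 := by
  have h := bb_eq (0 : Matrix (Fin 3) (Fin 3) F)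
  rw [rank_zero] at h
  rw [← h, aa, bb]
  apply Finset.sum_congr rfl
  intro v _
  rw [Finset.sum_eq_single 0]
  · simp
  · intro w _ hw
    rw [if_neg]
    rintro ⟨hv, h⟩
    exact hw (vmv_zero v w hv h.symm)
  · simp

lemma aa_one (B : Matrix (Fin 3) (Fin 3) F) (h : B.rank = 1) : aa B = (Fintype.card F : ℂ) - 1 := by
  obtain ⟨v, w, hv, rfl⟩ := rank_one_form B h
  have hw : w ≠ 0 := by rintro rfl; simp at h
  obtain ⟨i, hi⟩ := Function.ne_iff.mp hv
  obtain ⟨j, hj⟩ := Function.ne_iff.mp hw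
  simp only [Pi.zero_apply] at hi hj
  have : Fintype.card Fˣ = Fintype.card F - 1 := Fintype.card_units F
  have hc : (Fintype.card F : ℂ) - 1 = Fintype.card Fˣ := by
    rw [this, Nat.cast_sub Fintype.card_pos]; simp
  rw [hc, aa, ← Finset.sum_product', Finset.sum_boole]
  congr 1
  rw [← Finset.card_univ]
  symm
  apply Finset.card_bij (fun (c : Fˣ) _ => ((c:F) • v, ((c⁻¹ : Fˣ) : F) • w))
  · intro c _
    simp only [Finset.univ_product_univ, Finset.mem_filter, Finset.mem_univ, true_and]
    refine ⟨by simp [hv], ?_⟩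
    ext k l
    simp only [vecMulVec_apply, Pi.smul_apply, smul_eq_mul]
    have : (c:F) * ((c⁻¹ : Fˣ) : F) = 1 := by simp
    linear_combination (-(v k * w l)) * this
  · intro c _ d _ hcd
    have := congrFun (congrArg Prod.fst hcd) i
    simp [hi] at this
    exact Units.ext this
  · rintro ⟨v', w'⟩ hm
    simp only [Finset.univ_product_univ, Finset.mem_filter, Finset.mem_univ, true_and] at hm
    obtain ⟨hv', he⟩ := hm
    have he' : ∀ k l, v k * w l = v' k * w' l := fun k l => congrFun (congrFun he k) l
    have hne : v i * w j ≠ 0 := mul_ne_zero hi hj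
    have h2 : v' i ≠ 0 := by intro h; apply hne; rw [he', h, zero_mul]
    have h3 : w' j ≠ 0 := by intro h; apply hne; rw [he', h, mul_zero]
    refine ⟨Units.mk0 (v' i / v i) (div_ne_zero h2 hi), Finset.mem_univ _, ?_⟩
    ext k
    · simp only [Units.val_mk0, Pi.smul_apply, smul_eq_mul]
      have e1 := he' i j
      have e2 := he' k j
      field_simp
      apply mul_right_cancel₀ h3
      apply mul_right_cancel₀ hj
      linear_combination (w' j * v' i) * e2 - (v' k * w' j) * e1
    · simp only [Units.val_inv_eq_inv_val, Units.val_mk0, Pi.smul_apply, smul_eq_mul]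
      have e2 := he' i k
      field_simp
      linear_combination e2

lemma isUnit_iff_rank (B : Matrix (Fin 3) (Fin 3) F) : IsUnit B ↔ B.rank = 3 := by
  constructor
  · intro h; simpa using rank_of_isUnit B h
  · intro h
    rw [← Matrix.mulVec_surjective_iff_isUnit]
    have : LinearMap.range B.mulVecLin = ⊤ := by
      apply Submodule.eq_top_of_finrank_eq
      rw [Module.finrank_fin_fun]; exact h
    exact LinearMap.range_eq_top.mp this

lemma rank_cases (B : Matrix (Fin 3) (Fin 3) F) :
    B.rank = 0 ∨ B.rank = 1 ∨ B.rank = 2 ∨ B.rank = 3 := by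
  have := B.rank_le_width; omega

lemma moebius (U : Matrix (Fin 3) (Fin 3) F) :
    ((Fintype.card F : ℂ) - 1) * (if IsUnit U then 1 else 0) =
      ((Fintype.card F : ℂ) - 1) - bb U + Fintype.card F * aa U -
      ((Fintype.card F : ℂ) - 1) * (Fintype.card F : ℂ) ^ 3 * (if U = 0 then 1 else 0) := by
  rw [bb_eq]
  simp only [isUnit_iff_rank]
  simp only [← rank_eq_zero_iff']
  rcases rank_cases U with h | h | h | h
  · rw [(rank_eq_zero_iff' U).mp h, aa_zero]; simp; ring
  · rw [aa_one U h]; simp [h]; ring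
  · rw [aa_of_two_le U (by omega)]; simp [h]
  · rw [aa_of_two_le U (by omega)]; simp [h]

noncomputable def lam (ψ : AddChar F ℂ) (B : Matrix (Fin 3) (Fin 3) F) : ℂ :=
  ∑ U : Matrix (Fin 3) (Fin 3) F, (if IsUnit U then 1 else 0) * ψ (trace (U * B))

lemma sum_bb (ψ : AddChar F ℂ) (hψ : ψ.IsPrimitive) (B : Matrix (Fin 3) (Fin 3) F) :
    ∑ U : Matrix (Fin 3) (Fin 3) F, bb U * ψ (trace (U * B)) =
      (Fintype.card F : ℂ) ^ 6 * aa Bᵀ := by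
  have hq : (Fintype.card F : ℂ) ≠ 0 := by simp
  apply mul_left_cancel₀ (pow_ne_zero 3 hq)
  have h1 : ∀ (v : Fin 3 → F) (U : Matrix (Fin 3) (Fin 3) F),
      (Fintype.card F : ℂ) ^ 3 * (if v ≠ 0 ∧ v ᵥ* U = 0 then 1 else 0) =
      ∑ w : Fin 3 → F, (if v ≠ 0 then ψ (- (v ᵥ* U) ⬝ᵥ w) else 0) := by
    intro v U
    by_cases hv : v = 0
    · simp [hv]
    · simp only [ne_eq, hv, not_false_eq_true, true_and, if_true]
      rw [sum_dot ψ hψ]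
      simp
  calc _ = ∑ U : Matrix (Fin 3) (Fin 3) F, ∑ v : Fin 3 → F, ∑ w : Fin 3 → F,
        (if v ≠ 0 then ψ (- (v ᵥ* U) ⬝ᵥ w) else 0) * ψ (trace (U * B)) := by
        rw [Finset.mul_sum]
        apply Finset.sum_congr rfl; intro U _
        rw [bb, ← mul_assoc, Finset.mul_sum, Finset.sum_mul]
        apply Finset.sum_congr rfl; intro v _
        rw [h1, Finset.sum_mul]
    _ = ∑ v : Fin 3 → F, ∑ w : Fin 3 → F, ∑ U : Matrix (Fin 3) (Fin 3) F,
        (if v ≠ 0 then ψ (- (v ᵥ* U) ⬝ᵥ w) else 0) * ψ (trace (U * B)) := by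
        rw [Finset.sum_comm]
        apply Finset.sum_congr rfl; intro v _
        rw [Finset.sum_comm]
    _ = ∑ v : Fin 3 → F, ∑ w : Fin 3 → F, (Fintype.card F : ℂ) ^ 9 *
        (if v ≠ 0 ∧ Bᵀ = vecMulVec v w then 1 else 0) := by
        apply Finset.sum_congr rfl; intro v _
        apply Finset.sum_congr rfl; intro w _
        by_cases hv : v = 0
        · simp [hv]
        · simp only [ne_eq, hv, not_false_eq_true, true_and, if_true]
          have : ∀ U : Matrix (Fin 3) (Fin 3) F,
              ψ (- (v ᵥ* U) ⬝ᵥ w) * ψ (trace (U * B)) = ψ (trace (U * (B - vecMulVec w v))) := by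
            intro U
            rw [← AddChar.map_add_eq_mul]
            congr 1
            rw [mul_sub, trace_sub, mul_vecMulVec, trace_vecMulVec, neg_dotProduct,
              ← dotProduct_mulVec, dotProduct_comm v]
            ring
          simp only [this]
          rw [sum_tr ψ hψ]
          have e : B - vecMulVec w v = 0 ↔ Bᵀ = vecMulVec v w := by
            rw [sub_eq_zero, ← transpose_vecMulVec w v, transpose_inj]
          simp only [e]
          simp
    _ = _ := by
        rw [aa]
        simp only [Finset.mul_sum]
        apply Finset.sum_congr rfl; intro v _
        apply Finset.sum_congr rfl; intro w _
        ring

lemma sum_aa (ψ : AddChar F ℂ) (hψ : ψ.IsPrimitive) (B : Matrix (Fin 3) (Fin 3) F) :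
    ∑ U : Matrix (Fin 3) (Fin 3) F, aa U * ψ (trace (U * B)) =
      (Fintype.card F : ℂ) ^ 3 * bb Bᵀ := by
  simp only [aa, bb, Finset.sum_mul, Finset.mul_sum]
  rw [Finset.sum_comm]
  apply Finset.sum_congr rfl; intro v _
  rw [Finset.sum_comm]
  by_cases hv : v = 0
  · simp [hv]
  simp only [ne_eq, hv, not_false_eq_true, true_and, ite_mul, one_mul, zero_mul,
    Finset.sum_ite_eq', Finset.mem_univ, if_true]
  have : ∀ w : Fin 3 → F, trace (vecMulVec v w * B) = (B *ᵥ v) ⬝ᵥ w := by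
    intro w
    rw [vecMulVec_mul, trace_vecMulVec, dotProduct_comm, ← dotProduct_mulVec, dotProduct_comm]
  simp only [this]
  rw [sum_dot ψ hψ, vecMul_transpose]
  simp

lemma lam_eq (ψ : AddChar F ℂ) (hψ : ψ.IsPrimitive) (B : Matrix (Fin 3) (Fin 3) F) :
    ((Fintype.card F : ℂ) - 1) * lam ψ B =
      ((Fintype.card F : ℂ) - 1) * (if B = 0 then (Fintype.card F : ℂ) ^ 9 else 0)
      - (Fintype.card F : ℂ) ^ 6 * aa Bᵀ + (Fintype.card F : ℂ) ^ 4 * bb Bᵀ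
      - ((Fintype.card F : ℂ) - 1) * (Fintype.card F : ℂ) ^ 3 := by
  have h3 : ∑ U : Matrix (Fin 3) (Fin 3) F, (if U = 0 then (1:ℂ) else 0) * ψ (trace (U * B)) = 1 := by
    simp [ite_mul]
  have h : ((Fintype.card F : ℂ) - 1) * lam ψ B =
      ((Fintype.card F : ℂ) - 1) * (∑ U : Matrix (Fin 3) (Fin 3) F, ψ (trace (U * B)))
      - (∑ U : Matrix (Fin 3) (Fin 3) F, bb U * ψ (trace (U * B)))
      + Fintype.card F * (∑ U : Matrix (Fin 3) (Fin 3) F, aa U * ψ (trace (U * B)))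
      - ((Fintype.card F : ℂ) - 1) * (Fintype.card F : ℂ) ^ 3 *
        ∑ U : Matrix (Fin 3) (Fin 3) F, (if U = 0 then (1:ℂ) else 0) * ψ (trace (U * B)) := by
    rw [lam]
    simp only [Finset.mul_sum, ← Finset.sum_sub_distrib, ← Finset.sum_add_distrib]
    apply Finset.sum_congr rfl; intro U _
    rw [← mul_assoc, moebius]
    ring
  rw [h, h3, sum_tr ψ hψ, sum_aa ψ hψ, sum_bb ψ hψ]
  ring

lemma card_sub_one_ne : (Fintype.card F : ℂ) - 1 ≠ 0 := by
  have := Fintype.one_lt_card (α := F)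
  rw [sub_ne_zero]
  exact_mod_cast this.ne'

/-- eigenvalue by rank -/
noncomputable def ev (q : ℂ) (r : ℕ) : ℂ :=
  if r = 0 then q ^ 9 - q ^ 8 - q ^ 7 + q ^ 5 + q ^ 4 - q ^ 3
  else if r = 1 then -q ^ 6 + q ^ 5 + q ^ 4 - q ^ 3
  else if r = 2 then q ^ 4 - q ^ 3 else - q ^ 3

lemma lam_rank (ψ : AddChar F ℂ) (hψ : ψ.IsPrimitive) (B : Matrix (Fin 3) (Fin 3) F) :
    lam ψ B = ev (Fintype.card F) B.rank := by
  apply mul_left_cancel₀ (card_sub_one_ne (F := F))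
  rw [lam_eq ψ hψ, bb_eq, rank_transpose]
  have ht := rank_transpose B
  simp only [← rank_eq_zero_iff']
  rcases rank_cases B with h | h | h | h
  · rw [(rank_eq_zero_iff' B).mp h, transpose_zero, aa_zero]; simp [ev]; ring
  · rw [aa_one Bᵀ (by omega)]; simp [h, ev]; ring
  · rw [aa_of_two_le Bᵀ (by omega)]; simp [h, ev]; ring
  · rw [aa_of_two_le Bᵀ (by omega)]; simp [h, ev]

/-- number of matrices of rank r -/
noncomputable def nn (F : Type*) [Field F] [Fintype F] (r : ℕ) : ℕ :=
  (Finset.univ.filter (fun B : Matrix (Fin 3) (Fin 3) F => B.rank = r)).card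

lemma prod_rank {R : Type*} [CommMonoid R] (f : ℕ → R) :
    ∏ B : Matrix (Fin 3) (Fin 3) F, f B.rank =
      f 0 ^ nn F 0 * f 1 ^ nn F 1 * f 2 ^ nn F 2 * f 3 ^ nn F 3 := by
  rw [← Finset.prod_fiberwise_of_maps_to (t := Finset.range 4) (g := fun B => B.rank)
    (by intro B _; have := B.rank_le_width; simp; omega)]
  simp only [Finset.prod_range_succ, Finset.prod_range_zero, one_mul, nn]
  congr 1
  · congr 1
    · congr 1
      all_goals
        apply Finset.prod_eq_pow_card
        intro B hB
        rw [(Finset.mem_filter.mp hB).2]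
    · apply Finset.prod_eq_pow_card
      intro B hB
      rw [(Finset.mem_filter.mp hB).2]
  · apply Finset.prod_eq_pow_card
    intro B hB
    rw [(Finset.mem_filter.mp hB).2]

lemma sum_rank (f : ℕ → ℂ) :
    ∑ B : Matrix (Fin 3) (Fin 3) F, f B.rank =
      nn F 0 * f 0 + nn F 1 * f 1 + nn F 2 * f 2 + nn F 3 * f 3 := by
  have := prod_rank (F := F) (R := Multiplicative ℂ) (fun r => Multiplicative.ofAdd (f r))
  have := congrArg Multiplicative.toAdd this
  simpa [toAdd_prod] using this

lemma nn_zero : nn F 0 = 1 := by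
  rw [nn, Finset.card_eq_one]
  refine ⟨0, ?_⟩
  ext B
  simp [rank_eq_zero_iff']

lemma nn_three (ψ : AddChar F ℂ) (hψ : ψ.IsPrimitive) : (nn F 3 : ℂ) =
    (Fintype.card F : ℂ) ^ 9 - (Fintype.card F : ℂ) ^ 8 - (Fintype.card F : ℂ) ^ 7
      + (Fintype.card F : ℂ) ^ 5 + (Fintype.card F : ℂ) ^ 4 - (Fintype.card F : ℂ) ^ 3 := by
  have h := lam_rank ψ hψ (0 : Matrix (Fin 3) (Fin 3) F)
  rw [rank_zero] at h
  simp only [ev, if_true] at h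
  rw [← h, lam]
  simp [isUnit_iff_rank, nn]

lemma nn_total (ψ : AddChar F ℂ) (hψ : ψ.IsPrimitive) :
    (nn F 0 : ℂ) + nn F 1 + nn F 2 + nn F 3 = (Fintype.card F : ℂ) ^ 9 := by
  have h := sum_rank (F := F) (fun _ => 1)
  have h2 := sum_tr ψ hψ (0 : Matrix (Fin 3) (Fin 3) F)
  simp only [mul_zero, trace_zero, AddChar.map_zero_eq_one, if_true] at h2
  rw [← h2, h]; ring

lemma nn_one (ψ : AddChar F ℂ) (hψ : ψ.IsPrimitive) : (nn F 1 : ℂ) =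
    (Fintype.card F : ℂ) ^ 5 + (Fintype.card F : ℂ) ^ 4 + (Fintype.card F : ℂ) ^ 3
      - (Fintype.card F : ℂ) ^ 2 - (Fintype.card F : ℂ) - 1 := by
  have h := sum_aa ψ hψ (0 : Matrix (Fin 3) (Fin 3) F)
  rw [transpose_zero, bb_eq, rank_zero] at h
  have h2 := sum_rank (F := F) (fun r => if r = 0 then (Fintype.card F : ℂ) ^ 3 - 1 else
    if r = 1 then (Fintype.card F : ℂ) - 1 else 0)
  have h3 : ∀ U : Matrix (Fin 3) (Fin 3) F, aa U = (fun r : ℕ => if r = 0 then (Fintype.card F : ℂ) ^ 3 - 1 else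
    if r = 1 then (Fintype.card F : ℂ) - 1 else 0) U.rank := by
    intro U
    rcases rank_cases U with h | h | h | h
    · rw [(rank_eq_zero_iff' U).mp h, aa_zero]; simp
    · rw [aa_one U h]; simp [h]
    · rw [aa_of_two_le U (by omega)]; simp [h]
    · rw [aa_of_two_le U (by omega)]; simp [h]
  simp only [mul_zero, trace_zero, AddChar.map_zero_eq_one, mul_one] at h
  rw [Finset.sum_congr rfl (fun U _ => h3 U), h2, nn_zero] at h
  simp at h
  apply mul_left_cancel₀ (card_sub_one_ne (F := F))
  linear_combination h

lemma charpoly_conj {n : Type*} [Fintype n] [DecidableEq n] (M P Q : Matrix n n ℂ) (d : n → ℂ)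
    (h : M * P = P * diagonal d) (hPQ : P * Q = 1) : M.charpoly = ∏ i, (X - C (d i)) := by
  have hQP : Q * P = 1 := mul_eq_one_comm.mp hPQ
  have : M = (P * diagonal d) * Q := by rw [← h, mul_assoc, hPQ, mul_one]
  rw [this, charpoly_mul_comm, ← mul_assoc, hQP, one_mul, charpoly_diagonal]

lemma main [DecidableEq (Matrix (Fin 3) (Fin 3) F)] (ψ : AddChar F ℂ) (hψ : ψ.IsPrimitive)
    (M : Matrix (Matrix (Fin 3) (Fin 3) F) (Matrix (Fin 3) (Fin 3) F) ℂ)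
    (hM : ∀ A B, M A B = if IsUnit (B - A) then 1 else 0) :
    M.charpoly = ∏ B : Matrix (Fin 3) (Fin 3) F, (X - C (ev (Fintype.card F) B.rank)) := by
  have hq : (Fintype.card F : ℂ) ≠ 0 := by simp
  apply charpoly_conj M (Matrix.of fun A B => ψ (trace (A * B)))
    (Matrix.of fun A B => ((Fintype.card F : ℂ) ^ 9)⁻¹ * ψ (- trace (A * B)))
  · ext A B
    rw [mul_diagonal, ← lam_rank ψ hψ, Matrix.mul_apply, lam, Finset.mul_sum,
      ← Equiv.sum_comp (Equiv.addRight A)]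
    apply Finset.sum_congr rfl; intro U _
    simp only [Equiv.coe_addRight, hM, add_sub_cancel_right, of_apply, add_mul, trace_add,
      AddChar.map_add_eq_mul]
    ring
  · ext A B
    rw [Matrix.mul_apply]
    have : ∀ U : Matrix (Fin 3) (Fin 3) F, ψ (trace (A * U)) *
        (((Fintype.card F : ℂ) ^ 9)⁻¹ * ψ (- trace (U * B))) =
        ((Fintype.card F : ℂ) ^ 9)⁻¹ * ψ (trace (U * (A - B))) := by
      intro U
      rw [mul_left_comm, ← AddChar.map_add_eq_mul, mul_sub, trace_sub, trace_mul_comm A, sub_eq_add_neg]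
    simp only [of_apply, this]
    rw [← Finset.mul_sum, sum_tr ψ hψ, Matrix.one_apply]
    by_cases hAB : A = B
    · subst hAB; simp [hq]
    · rw [if_neg hAB, if_neg (sub_ne_zero.mpr hAB), mul_zero]

end UG3

/-- The characteristic polynomial of the adjacency matrix of the unit-graph on
`Mat₃(F_q)` (with `M A B = 1` iff `B - A` is invertible) is
`(X-λ₀)^{m₀}(X-λ₁)^{m₁}(X-λ₂)^{m₂}(X-λ₃)^{m₃}` with
`λ₀ = q^9-q^8-q^7+q^5+q^4-q^3`, `m₀ = 1`;
`λ₁ = -q^6+q^5+q^4-q^3`, `m₁ = q^5+q^4+q^3-q^2-q-1`;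
`λ₂ = q^4-q^3`, `m₂ = q^8+q^7-2q^5-2q^4+q^2+q`;
`λ₃ = -q^3`, `m₃ = q^9-q^8-q^7+q^5+q^4-q^3`. -/
theorem charpoly_unitGraph_Mat3 (q : ℕ) (F : Type*) [Field F] [Fintype F] [DecidableEq F]
    (hq : Fintype.card F = q)
    (M : Matrix (Matrix (Fin 3) (Fin 3) F) (Matrix (Fin 3) (Fin 3) F) ℂ)
    (hM : ∀ A B, M A B = if IsUnit (B - A) then 1 else 0)
    (lam0 lam1 lam2 lam3 : ℂ)
    (hlam0 : lam0 = (q : ℂ) ^ 9 - q ^ 8 - q ^ 7 + q ^ 5 + q ^ 4 - q ^ 3)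
    (hlam1 : lam1 = -(q : ℂ) ^ 6 + q ^ 5 + q ^ 4 - q ^ 3)
    (hlam2 : lam2 = (q : ℂ) ^ 4 - q ^ 3)
    (hlam3 : lam3 = -(q : ℂ) ^ 3)
    (m0 m1 m2 m3 : ℕ)
    (hm0 : m0 = 1)
    (hm1 : (m1 : ℤ) = (q : ℤ) ^ 5 + q ^ 4 + q ^ 3 - q ^ 2 - q - 1)
    (hm2 : (m2 : ℤ) = (q : ℤ) ^ 8 + q ^ 7 - 2 * q ^ 5 - 2 * q ^ 4 + q ^ 2 + q)
    (hm3 : (m3 : ℤ) = (q : ℤ) ^ 9 - q ^ 8 - q ^ 7 + q ^ 5 + q ^ 4 - q ^ 3) :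
    M.charpoly =
      (X - C lam0) ^ m0 * (X - C lam1) ^ m1 * (X - C lam2) ^ m2 * (X - C lam3) ^ m3 := by
  have hψ := AddChar.FiniteField.primitiveChar_to_Complex_isPrimitive F
  have hmain := UG3.main _ hψ M hM
  have h0 := UG3.nn_zero (F := F)
  have h1 := UG3.nn_one _ hψ
  have h3 := UG3.nn_three _ hψ
  have ht := UG3.nn_total _ hψ
  rw [hq] at h1 h3 ht hmain
  have e1 : UG3.nn F 1 = m1 := by
    have : ((m1 : ℤ) : ℂ) = _ := congrArg (Int.cast : ℤ → ℂ) hm1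
    push_cast at this
    have : (UG3.nn F 1 : ℂ) = m1 := by rw [h1, this]
    exact_mod_cast this
  have e3 : UG3.nn F 3 = m3 := by
    have : ((m3 : ℤ) : ℂ) = _ := congrArg (Int.cast : ℤ → ℂ) hm3
    push_cast at this
    have : (UG3.nn F 3 : ℂ) = m3 := by rw [h3, this]
    exact_mod_cast this
  have e2 : UG3.nn F 2 = m2 := by
    have : ((m2 : ℤ) : ℂ) = _ := congrArg (Int.cast : ℤ → ℂ) hm2
    push_cast at this
    have : (UG3.nn F 2 : ℂ) = m2 := by
      rw [this]
      rw [h0, h1, h3] at ht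
      push_cast at ht
      linear_combination ht
    exact_mod_cast this
  rw [UG3.prod_rank (F := F) (fun r => X - C (UG3.ev (q : ℂ) r)), h0, e1, e2, e3] at hmain
  rw [hm0, hlam0, hlam1, hlam2, hlam3]
  simpa [UG3.ev] using hmain
end
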